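/- Let N_n be Multinomial(n, q) with q in the 3-dimensional probability simplex, and given N_n = n_n let (V*, V*_1, V*_2, V*_3, V*_4) be Dirichlet(1, n_n). Let S_n be the random subset of the 3-dimensional probability simplex consisting of all q' with V*_i ≤ q'_i for all i in {1,2,3,4}. Then sqrt(n) times the diameter of S_n converges to 0 in probability (jointly over the multinomial data and the Dirichlet randomness) as n tends to infinity; consequently, for any open ball B containing q, the conditional probability P*(S_n ⊂ B) converges to 1 in probability. -/

import Mathlib

open MeasureTheory ProbabilityTheory Filter
open scoped ENNReal NNReal Topology

/-- The categorical distribution on a finite type. -/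
noncomputable def categorical {ι : Type*} [Fintype ι] [MeasurableSpace ι] (q : ι → ℝ) :
    Measure ι := ∑ i : ι, ENNReal.ofReal (q i) • Measure.dirac i

/-- The multinomial distribution of category counts for `n` independent trials. -/
noncomputable def multinomial (ι : Type*) [Fintype ι] [DecidableEq ι] [MeasurableSpace ι]
    (n : ℕ) (q : ι → ℝ) : Measure (ι → ℕ) :=
  Measure.map (fun (x : Fin n → ι) (j : ι) => (Finset.univ.filter (fun i => x i = j)).card)
    (Measure.pi fun _ : Fin n => categorical q)

/-- The Gamma distribution with shape `a` and rate `1`, with the convention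
`Gamma(0, 1) = δ₀`. -/
noncomputable def gammaShape (a : ℝ) : Measure ℝ :=
  if a = 0 then Measure.dirac 0 else gammaMeasure a 1

/-- The Dirichlet distribution with shape vector `a`. -/
noncomputable def dirichlet {ι : Type*} [Fintype ι] (a : ι → ℝ) : Measure (ι → ℝ) :=
  Measure.map (fun x i => x i / ∑ j : ι, x j) (Measure.pi fun i : ι => gammaShape (a i))

/-- The Dirichlet shape vector `(1, c)` associated with counts `c`. -/
def shapeOf4 (c : Fin 4 → ℕ) : Option (Fin 4) → ℝ :=
  fun o => o.elim 1 (fun i => (c i : ℝ))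

/-- The random polytope `S`: all points `q'` of the 3-dimensional probability simplex
(viewed inside Euclidean space `ℝ⁴`) with `V*_i ≤ q'_i` for `i ∈ {1, 2, 3, 4}`. -/
def Spoly (v : Option (Fin 4) → ℝ) : Set (EuclideanSpace ℝ (Fin 4)) :=
  {q' | (fun i => q' i) ∈ stdSimplex ℝ (Fin 4) ∧ ∀ i : Fin 4, v (some i) ≤ q' i}

lemma gamma_shift {a : ℝ} (ha : 0 < a) (x : ℝ) :
    gammaPDF a 1 x * ENNReal.ofReal x = ENNReal.ofReal a * gammaPDF (a + 1) 1 x := by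
  rcases lt_or_ge x 0 with hx | hx
  · rw [gammaPDF_of_neg hx, gammaPDF_of_neg hx]; simp
  · rw [gammaPDF_of_nonneg hx, gammaPDF_of_nonneg hx, ← ENNReal.ofReal_mul' hx,
      ← ENNReal.ofReal_mul ha.le]
    congr 1
    have hG := (Real.Gamma_pos_of_pos ha).ne'
    rw [Real.Gamma_add_one ha.ne']
    have : x ^ (a + 1 - 1) = x ^ (a - 1) * x := by
      rcases hx.eq_or_lt with h | h
      · subst h
        rw [mul_zero, Real.zero_rpow]; simp [ha.ne']
      · rw [← Real.rpow_add_one h.ne']; ring_nf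
    rw [this]
    simp only [Real.one_rpow]
    field_simp

lemma measurable_gammaPDF' (a r : ℝ) : Measurable (gammaPDF a r) :=
  (measurable_gammaPDFReal a r).ennreal_ofReal

lemma gamma_nonneg_ae {a : ℝ} : ∀ᵐ x ∂(gammaMeasure a 1), 0 ≤ x := by
  rw [gammaMeasure, ae_withDensity_iff (measurable_gammaPDF' a 1)]
  refine Eventually.of_forall fun x hx => ?_
  by_contra h
  exact hx (gammaPDF_of_neg (not_le.mp h))

lemma gamma_m1 {a : ℝ} (ha : 0 < a) :
    ∫⁻ x, ENNReal.ofReal x ∂(gammaMeasure a 1) = ENNReal.ofReal a := by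
  rw [gammaMeasure, lintegral_withDensity_eq_lintegral_mul _ (measurable_gammaPDF' a 1)
    (by fun_prop)]
  simp only [Pi.mul_apply, gamma_shift ha]
  rw [lintegral_const_mul _ (measurable_gammaPDF' _ 1),
    lintegral_gammaPDF_eq_one (by linarith) one_pos, mul_one]

lemma gamma_m2 {a : ℝ} (ha : 0 < a) :
    ∫⁻ x, ENNReal.ofReal (x ^ 2) ∂(gammaMeasure a 1) = ENNReal.ofReal (a * (a + 1)) := by
  have h : ∫⁻ x, ENNReal.ofReal (x ^ 2) ∂(gammaMeasure a 1)
      = ∫⁻ x, ENNReal.ofReal x * ENNReal.ofReal x ∂(gammaMeasure a 1) := by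
    refine lintegral_congr_ae ?_
    filter_upwards [gamma_nonneg_ae] with x hx
    rw [← ENNReal.ofReal_mul hx, sq]
  rw [h, gammaMeasure, lintegral_withDensity_eq_lintegral_mul _ (measurable_gammaPDF' a 1)
    (by fun_prop)]
  simp only [Pi.mul_apply, ← mul_assoc, gamma_shift ha]
  simp only [mul_assoc, gamma_shift (show 0 < a + 1 by linarith)]
  rw [lintegral_const_mul _ (by have := measurable_gammaPDF' (a+1+1) 1; fun_prop),
    lintegral_const_mul _ (measurable_gammaPDF' _ 1),
    lintegral_gammaPDF_eq_one (by linarith) one_pos, mul_one, ENNReal.ofReal_mul ha.le]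

instance gammaShape_prob (a : ℝ≥0) : IsProbabilityMeasure (gammaShape a) := by
  unfold gammaShape
  split_ifs with h
  · infer_instance
  · exact isProbabilityMeasure_gammaMeasure (lt_of_le_of_ne a.2 (Ne.symm h)) one_pos

lemma gammaShape_prob' {a : ℝ} (ha : 0 ≤ a) : IsProbabilityMeasure (gammaShape a) :=
  gammaShape_prob ⟨a, ha⟩

lemma gammaShape_cheb {a : ℝ} (ha : 0 ≤ a) {s : ℝ} (hs : 0 < s) :
    gammaShape a {x | s ≤ |x - a|} ≤ ENNReal.ofReal (a / s ^ 2) := by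
  rcases ha.eq_or_lt with h | h
  · subst h
    rw [gammaShape, if_pos rfl, Measure.dirac_apply' _ (by measurability)]
    simp [hs]
  · rw [gammaShape, if_neg h.ne']
    have := isProbabilityMeasure_gammaMeasure h one_pos
    have e2 : ∫ x, x ^ 2 ∂(gammaMeasure a 1) = a * (a + 1) := by
      rw [integral_eq_lintegral_of_nonneg_ae (Eventually.of_forall fun x => sq_nonneg x)
        (by fun_prop), gamma_m2 h, ENNReal.toReal_ofReal (by positivity)]
    have e1 : ∫ x, x ∂(gammaMeasure a 1) = a := by
      rw [integral_eq_lintegral_of_nonneg_ae gamma_nonneg_ae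
        (by fun_prop), gamma_m1 h, ENNReal.toReal_ofReal h.le]
    have hL : MemLp (fun x : ℝ => x) 2 (gammaMeasure a 1) := by
      rw [memLp_two_iff_integrable_sq (by fun_prop)]
      by_contra hc
      rw [integral_undef hc] at e2
      have : 0 < a * (a + 1) := by positivity
      linarith
    have hc := meas_ge_le_variance_div_sq hL hs
    rw [variance_eq_sub hL] at hc
    simp only [Pi.pow_apply, e1, e2] at hc
    convert! hc using 3
    ring

lemma shapeOf4_nonneg (c : Fin 4 → ℕ) (o : Option (Fin 4)) : 0 ≤ shapeOf4 c o := by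
  cases o <;> simp [shapeOf4]

lemma pi_prob (c : Fin 4 → ℕ) :
    IsProbabilityMeasure (Measure.pi fun o => gammaShape (shapeOf4 c o)) := by
  have := fun o => gammaShape_prob' (shapeOf4_nonneg c o)
  infer_instance

lemma pi_cheb (c : Fin 4 → ℕ) (o : Option (Fin 4)) {s : ℝ} (hs : 0 < s) :
    (Measure.pi fun o => gammaShape (shapeOf4 c o)) {x | s ≤ |x o - shapeOf4 c o|}
      ≤ ENNReal.ofReal (shapeOf4 c o / s ^ 2) := by
  have := fun o => gammaShape_prob' (shapeOf4_nonneg c o)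
  have h := (measurePreserving_eval (fun o => gammaShape (shapeOf4 c o)) o).measure_preimage
    (s := {x | s ≤ |x - shapeOf4 c o|}) (by measurability)
  exact h.trans_le (gammaShape_cheb (shapeOf4_nonneg c o) hs)

lemma dir_meas : Measurable (fun (x : Option (Fin 4) → ℝ) i => x i / ∑ j, x j) := by
  fun_prop

lemma dir_prob (c : Fin 4 → ℕ) : IsProbabilityMeasure (dirichlet (shapeOf4 c)) := by
  have := pi_prob c
  exact Measure.isProbabilityMeasure_map dir_meas.aemeasurable

/-- The good set of Dirichlet vectors. -/
def Good (n : ℕ) (c : Fin 4 → ℕ) (δ : ℝ) : Set (Option (Fin 4) → ℝ) :=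
  {v | ∑ o, v o = 1 ∧ Real.sqrt n * |v none| ≤ δ ∧ ∀ i, |v (some i) - (c i : ℝ) / n| ≤ δ}

lemma good_meas (n : ℕ) (c : Fin 4 → ℕ) (δ : ℝ) : MeasurableSet (Good n c δ) := by
  have h1 : MeasurableSet {v : Option (Fin 4) → ℝ | ∑ o, v o = 1} :=
    measurableSet_eq_fun (by fun_prop) (by fun_prop)
  have h2 : MeasurableSet {v : Option (Fin 4) → ℝ | Real.sqrt n * |v none| ≤ δ} :=
    measurableSet_le (by fun_prop) (by fun_prop)
  have h3 : ∀ i, MeasurableSet {v : Option (Fin 4) → ℝ | |v (some i) - (c i : ℝ) / n| ≤ δ} :=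
    fun i => measurableSet_le (by fun_prop) (by fun_prop)
  have e : Good n c δ = {v : Option (Fin 4) → ℝ | ∑ o, v o = 1} ∩
      ({v : Option (Fin 4) → ℝ | Real.sqrt n * |v none| ≤ δ} ∩
      ⋂ i, {v : Option (Fin 4) → ℝ | |v (some i) - (c i : ℝ) / n| ≤ δ}) := by
    ext v; simp [Good]
  rw [e]
  exact h1.inter (h2.inter (MeasurableSet.iInter h3))

lemma good_of (n : ℕ) (c : Fin 4 → ℕ) (hc : ∑ i, c i = n) (hn : 0 < n) {t δ : ℝ} (ht : 0 < t)
    (ht1 : t ≤ 1 / 12) (htδ : 14 * t ≤ δ) (hnt : 1 ≤ t * Real.sqrt n)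
    (x : Option (Fin 4) → ℝ) (h0 : |x none - 1| < t * Real.sqrt n)
    (hi : ∀ i, |x (some i) - (c i : ℝ)| < t * n) :
    (fun i => x i / ∑ j, x j) ∈ Good n c δ := by
  have hn' : (1 : ℝ) ≤ n := by exact_mod_cast hn
  set r := Real.sqrt n with hr
  have hr2 : r * r = n := Real.mul_self_sqrt (by positivity)
  have hr0 : 0 ≤ r := Real.sqrt_nonneg _
  have hr1 : 1 ≤ r := by rw [hr]; exact Real.one_le_sqrt.mpr hn'
  have hrn : r ≤ n := by nlinarith
  have hx0 : |x none| ≤ 2 * t * r := by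
    rw [abs_lt] at h0; rw [abs_le]; constructor <;> linarith
  have htr : t * r ≤ t * n := by gcongr
  have hcR : ∑ i, (c i : ℝ) = n := by exact_mod_cast hc
  set S := ∑ j, x j with hS
  have hS1 : |S - n| ≤ 6 * t * n := by
    have : S - n = x none + ∑ i, (x (some i) - (c i : ℝ)) := by
      rw [hS, Fintype.sum_option, Finset.sum_sub_distrib, hcR]; ring
    rw [this]
    have h2 : |∑ i, (x (some i) - (c i : ℝ))| ≤ ∑ i : Fin 4, t * n :=
      (Finset.abs_sum_le_sum_abs _ _).trans (Finset.sum_le_sum fun i _ => (hi i).le)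
    rw [Finset.sum_const, Finset.card_univ, Fintype.card_fin, nsmul_eq_mul] at h2
    push_cast at h2
    have := abs_add_le (x none) (∑ i, (x (some i) - (c i : ℝ)))
    linarith
  have hSn : (n : ℝ) / 2 ≤ S := by
    have := (abs_le.mp hS1).1
    nlinarith
  have hSpos : 0 < S := by linarith
  refine ⟨?_, ?_, fun i => ?_⟩
  · rw [← Finset.sum_div, div_self hSpos.ne']
  · rw [abs_div, abs_of_pos hSpos, ← mul_div_assoc, div_le_iff₀ hSpos]
    have : r * |x none| ≤ 2 * t * n := by
      calc r * |x none| ≤ r * (2 * t * r) := by gcongr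
        _ = 2 * t * n := by rw [← hr2]; ring
    nlinarith
  · have hcn : (c i : ℝ) ≤ n := by
      rw [← hcR]
      exact Finset.single_le_sum (f := fun i => (c i : ℝ)) (fun _ _ => by positivity)
        (Finset.mem_univ i)
    have e : x (some i) / S - (c i : ℝ) / n
        = ((x (some i) - c i) + (c i : ℝ) / n * (n - S)) / S := by
      field_simp; ring
    have hcn' : (c i : ℝ) / n ≤ 1 := by rw [div_le_one (by linarith)]; exact hcn
    have hcn0 : 0 ≤ (c i : ℝ) / n := by positivity
    show |x (some i) / S - (c i : ℝ) / n| ≤ δ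
    rw [e, abs_div, abs_of_pos hSpos, div_le_iff₀ hSpos]
    have h3 : |(c i : ℝ) / n * (n - S)| ≤ 6 * t * n := by
      rw [abs_mul, abs_of_nonneg hcn0, abs_sub_comm]
      calc _ ≤ 1 * |S - n| := by gcongr
        _ ≤ _ := by linarith
    have := abs_add_le (x (some i) - c i) ((c i : ℝ) / n * (n - S))
    have := hi i
    nlinarith

lemma bad_le (n : ℕ) (c : Fin 4 → ℕ) (hc : ∑ i, c i = n) (hn : 0 < n) {t δ : ℝ} (ht : 0 < t)
    (ht1 : t ≤ 1 / 12) (htδ : 14 * t ≤ δ) (hnt : 1 ≤ t * Real.sqrt n) :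
    dirichlet (shapeOf4 c) (Good n c δ)ᶜ ≤ ENNReal.ofReal (5 / (t ^ 2 * n)) := by
  have hn' : (1 : ℝ) ≤ n := by exact_mod_cast hn
  rw [dirichlet, Measure.map_apply dir_meas (good_meas n c δ).compl]
  set μ := Measure.pi fun o => gammaShape (shapeOf4 c o)
  have hsub : (fun (x : Option (Fin 4) → ℝ) i => x i / ∑ j, x j) ⁻¹' (Good n c δ)ᶜ ⊆
      {x | t * Real.sqrt n ≤ |x none - shapeOf4 c none|} ∪
      ⋃ i : Fin 4, {x | t * n ≤ |x (some i) - shapeOf4 c (some i)|} := by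
    intro x hx
    by_contra hcon
    simp only [Set.mem_union, Set.mem_iUnion, Set.mem_ofPred_eq, not_or, not_exists, not_le] at hcon
    exact hx (good_of n c hc hn ht ht1 htδ hnt x hcon.1 hcon.2)
  have hcn : ∀ i, (c i : ℝ) ≤ n := fun i => by
    have : c i ≤ n := by
      rw [← hc]; exact Finset.single_le_sum (f := c) (fun _ _ => by positivity) (Finset.mem_univ i)
    exact_mod_cast this
  have b0 : μ {x | t * Real.sqrt n ≤ |x none - shapeOf4 c none|}
      ≤ ENNReal.ofReal (1 / (t ^ 2 * n)) := by
    refine (pi_cheb c none (by positivity)).trans (ENNReal.ofReal_le_ofReal (le_of_eq ?_))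
    rw [mul_pow, Real.sq_sqrt (by positivity)]; rfl
  have bi : ∀ i, μ {x | t * n ≤ |x (some i) - shapeOf4 c (some i)|}
      ≤ ENNReal.ofReal (1 / (t ^ 2 * n)) := by
    intro i
    refine (pi_cheb c (some i) (by positivity)).trans (ENNReal.ofReal_le_ofReal ?_)
    show (c i : ℝ) / _ ≤ _
    rw [div_le_div_iff₀ (by positivity) (by positivity)]
    have : (c i : ℝ) * (t ^ 2 * n) ≤ n * (t ^ 2 * n) :=
      mul_le_mul_of_nonneg_right (hcn i) (by positivity)
    linarith
  refine (measure_mono hsub).trans ((measure_union_le _ _).trans ?_)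
  refine (add_le_add b0 ((measure_iUnion_fintype_le μ _).trans
    (Finset.sum_le_sum fun i _ => bi i))).trans ?_
  rw [← ENNReal.ofReal_sum_of_nonneg (fun _ _ => by positivity),
    ← ENNReal.ofReal_add (by positivity) (by positivity)]
  refine ENNReal.ofReal_le_ofReal (le_of_eq ?_)
  simp; ring

lemma bad_tendsto {δ : ℝ} (hδ : 0 < δ) {ε : ℝ≥0∞} (hε : 0 < ε) :
    ∀ᶠ n : ℕ in atTop, ∀ c : Fin 4 → ℕ, ∑ i, c i = n →
      dirichlet (shapeOf4 c) (Good n c δ)ᶜ ≤ ε := by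
  set t := min (1 / 12) (δ / 14) with ht
  have ht0 : 0 < t := by positivity
  have hT : Tendsto (fun n : ℕ => ENNReal.ofReal (5 / (t ^ 2 * n))) atTop (𝓝 0) := by
    rw [← ENNReal.ofReal_zero]
    refine ENNReal.tendsto_ofReal (Tendsto.const_div_atTop ?_ _)
    exact tendsto_natCast_atTop_atTop.const_mul_atTop (by positivity)
  have hT2 : Tendsto (fun n : ℕ => t * Real.sqrt n) atTop atTop :=
    (Real.tendsto_sqrt_atTop.comp tendsto_natCast_atTop_atTop).const_mul_atTop ht0
  filter_upwards [hT.eventually_le_const hε, hT2.eventually_ge_atTop 1,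
    eventually_gt_atTop 0] with n h1 h2 h3 c hc
  have := min_le_right (1 / 12) (δ / 14)
  exact (bad_le n c hc h3 ht0 (min_le_left _ _) (by linarith) h2).trans h1

lemma spoly_coord {v : Option (Fin 4) → ℝ} (hv : ∑ o, v o = 1)
    {x : EuclideanSpace ℝ (Fin 4)} (hx : x ∈ Spoly v) (i : Fin 4) :
    v (some i) ≤ x i ∧ x i ≤ v (some i) + v none := by
  refine ⟨hx.2 i, ?_⟩
  have h1 := hx.1.2
  rw [Fintype.sum_option] at hv
  have : x i - v (some i) ≤ ∑ j, (x j - v (some j)) :=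
    Finset.single_le_sum (f := fun j => x j - v (some j))
      (fun j _ => sub_nonneg.mpr (hx.2 j)) (Finset.mem_univ i)
  rw [Finset.sum_sub_distrib] at this
  simp only at h1
  linarith

lemma dist_le_of {x y : EuclideanSpace ℝ (Fin 4)} {d : ℝ} (hd : 0 ≤ d)
    (h : ∀ i, |x i - y i| ≤ d) : dist x y ≤ 2 * d := by
  rw [EuclideanSpace.dist_eq]
  refine Real.sqrt_le_iff.mpr ⟨by positivity, ?_⟩
  calc ∑ i, dist (x i) (y i) ^ 2 ≤ ∑ i : Fin 4, d ^ 2 :=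
        Finset.sum_le_sum fun i _ => by rw [Real.dist_eq]; gcongr; exact h i
    _ = (2 * d) ^ 2 := by simp; ring

lemma spoly_diam {v : Option (Fin 4) → ℝ} (hv : ∑ o, v o = 1) :
    Metric.diam (Spoly v) ≤ 2 * |v none| := by
  refine Metric.diam_le_of_forall_dist_le (by positivity) fun x hx y hy => ?_
  refine dist_le_of (abs_nonneg _) fun i => ?_
  have h1 := spoly_coord hv hx i
  have h2 := spoly_coord hv hy i
  have := le_abs_self (v none)
  rw [abs_le]; constructor <;> linarith

lemma categorical_prob {q : Fin 4 → ℝ} (hq : q ∈ stdSimplex ℝ (Fin 4)) :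
    IsProbabilityMeasure (categorical q) := by
  constructor
  simp only [categorical, Measure.coe_finsetSum, Finset.sum_apply, Measure.smul_apply,
    measure_univ, smul_eq_mul, mul_one]
  rw [← ENNReal.ofReal_sum_of_nonneg fun i _ => hq.1 i, hq.2, ENNReal.ofReal_one]

lemma count_meas (n : ℕ) : Measurable
    (fun (x : Fin n → Fin 4) (j : Fin 4) => (Finset.univ.filter (fun i => x i = j)).card) :=
  measurable_of_finite _

lemma multinomial_prob {q : Fin 4 → ℝ} (hq : q ∈ stdSimplex ℝ (Fin 4)) (n : ℕ) :
    IsProbabilityMeasure (multinomial (Fin 4) n q) := by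
  have := categorical_prob hq
  exact Measure.isProbabilityMeasure_map (count_meas n).aemeasurable

lemma multinomial_sum (q : Fin 4 → ℝ) (n : ℕ) :
    ∀ᵐ c ∂(multinomial (Fin 4) n q), ∑ i, c i = n := by
  rw [multinomial, ae_map_iff (count_meas n).aemeasurable (Set.to_countable _).measurableSet]
  refine Eventually.of_forall fun x => ?_
  have := Finset.card_eq_sum_card_fiberwise (f := x) (s := Finset.univ) (t := Finset.univ)
    (fun _ _ => Finset.mem_univ _)
  simpa using this.symm

lemma multinomial_cheb {q : Fin 4 → ℝ} (hq : q ∈ stdSimplex ℝ (Fin 4)) (n : ℕ) (hn : 0 < n)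
    (i : Fin 4) {η : ℝ} (hη : 0 < η) :
    multinomial (Fin 4) n q {c | η ≤ |(c i : ℝ) / n - q i|} ≤ ENNReal.ofReal (1 / (η ^ 2 * n)) := by
  have hp := categorical_prob hq
  have hn' : (1 : ℝ) ≤ n := by exact_mod_cast hn
  rw [multinomial, Measure.map_apply (count_meas n) (Set.to_countable _).measurableSet]
  set μ := Measure.pi fun _ : Fin n => categorical q
  set f : Fin 4 → ℝ := fun j => if j = i then 1 else 0 with hf
  have hfL : MemLp f 2 (categorical q) := MemLp.of_bound (measurable_of_finite _).aestronglyMeasurable 1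
    (Eventually.of_forall fun j => by simp only [hf]; split_ifs <;> simp)
  have hfi : ∫ j, f j ∂(categorical q) = q i := by
    rw [integral_fintype (hfL.integrable (by norm_num))]
    simp [hf, categorical, measureReal_def, Finset.sum_apply, Set.indicator_apply,
      ENNReal.toReal_ofReal (hq.1 i)]
  have hfv : Var[f; categorical q] ≤ 1 := by
    refine (variance_le_sq_of_bounded (a := 0) (b := 1) (Eventually.of_forall fun j => ?_)
      (measurable_of_finite _).aemeasurable).trans (by norm_num)
    simp only [hf]; split_ifs <;> simp
  have hpi : ∀ k : Fin n, MemLp (fun x : Fin n → Fin 4 => f (x k)) 2 μ := fun k =>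
    hfL.comp_measurePreserving (measurePreserving_eval (fun _ : Fin n => categorical q) k)
  have hv := variance_sum_pi (μ := fun _ : Fin n => categorical q) (X := fun _ => f) (fun _ => hfL)
  have hsL : MemLp (∑ k : Fin n, fun x : Fin n → Fin 4 => f (x k)) 2 μ :=
    memLp_finsetSum' _ fun k _ => hpi k
  have hvar : Var[∑ k : Fin n, fun x : Fin n → Fin 4 => f (x k); μ] ≤ n := by
    rw [hv]
    refine (Finset.sum_le_sum fun k _ => hfv).trans (by simp)
  have hmean : ∫ x, (∑ k : Fin n, fun x : Fin n → Fin 4 => f (x k)) x ∂μ = n * q i := by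
    simp only [Finset.sum_apply]
    rw [integral_finsetSum _ fun k _ => (hpi k).integrable (by norm_num)]
    have : ∀ k : Fin n, ∫ x, f (x k) ∂μ = q i := fun k => by
      rw [← hfi]
      exact integral_comp_eval (μ := fun _ : Fin n => categorical q) (i := k)
        hfL.aestronglyMeasurable
    simp [this]
  have hch := meas_ge_le_variance_div_sq hsL (show 0 < η * n by positivity)
  rw [hmean] at hch
  refine (measure_mono ?_).trans (hch.trans (ENNReal.ofReal_le_ofReal ?_))
  · intro x hx
    simp only [Set.mem_preimage, Set.mem_ofPred_eq] at hx ⊢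
    have e : (∑ k : Fin n, fun x : Fin n → Fin 4 => f (x k)) x
        = ((Finset.univ.filter (fun k => x k = i)).card : ℝ) := by
      simp [hf]
    rw [e]
    have e2 : ((Finset.univ.filter (fun k => x k = i)).card : ℝ) - n * q i
        = (((Finset.univ.filter (fun k => x k = i)).card : ℝ) / n - q i) * n := by
      field_simp
    rw [e2, abs_mul, abs_of_pos (show (0:ℝ) < n by linarith)]
    gcongr
  · rw [div_le_div_iff₀ (by positivity) (by positivity)]
    have : Var[∑ k : Fin n, fun x : Fin n → Fin 4 => f (x k); μ] * (η ^ 2 * n)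
      ≤ n * (η ^ 2 * n) := by gcongr
    linarith

/-- **Shrinkage of the fiducial random polytope** (used in the proof of Theorem 1).
Let `N_n ~ Multinomial(n, q)` with `q` in the 3-dimensional probability simplex and,
given the counts `N_n = c`, let `(V*, V*_1, …, V*_4) ~ Dirichlet(1, c)`, and let `S_n`
be the random subset of the simplex cut out by `V*_i ≤ q'_i`.  Then
(1) `√n · diam S_n → 0` in probability jointly over the data and the Dirichlet
randomness (the joint probability being the multinomial average of the conditional
Dirichlet probability), and
(2) for every open (Euclidean) ball `B` containing `q`, the conditional probability
`P*(S_n ⊆ B)` converges to `1` in probability. -/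
theorem fiducial_polytope_shrinks (q : Fin 4 → ℝ) (hq : q ∈ stdSimplex ℝ (Fin 4)) :
    (∀ ε : ℝ, 0 < ε →
      Tendsto
        (fun n : ℕ =>
          ∫⁻ c, (dirichlet (shapeOf4 c))
              {v | ε ≤ Real.sqrt n * Metric.diam (Spoly v)}
            ∂(multinomial (Fin 4) n q))
        atTop (𝓝 0)) ∧
    (∀ (x : EuclideanSpace ℝ (Fin 4)) (r : ℝ),
      (WithLp.equiv 2 (Fin 4 → ℝ)).symm q ∈ Metric.ball x r →
      ∀ ε : ℝ, 0 < ε →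
        Tendsto
          (fun n : ℕ =>
            multinomial (Fin 4) n q
              {c | ε ≤ |1 - ((dirichlet (shapeOf4 c))
                  {v | Spoly v ⊆ Metric.ball x r}).toReal|})
          atTop (𝓝 0)) := by
  constructor
  · intro ε hε
    rw [ENNReal.tendsto_atTop_zero]
    intro e he
    obtain ⟨N, hN⟩ := eventually_atTop.mp (bad_tendsto (δ := ε / 4) (by positivity) he)
    refine ⟨N, fun n hn => ?_⟩
    have := multinomial_prob hq n
    calc _ ≤ ∫⁻ c, e ∂(multinomial (Fin 4) n q) := by
          refine lintegral_mono_ae ?_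
          filter_upwards [multinomial_sum q n] with c hc
          refine (measure_mono ?_).trans (hN n hn c hc)
          intro v hv hG
          have h1 := spoly_diam hG.1
          have h2 := hG.2.1
          have h3 : Real.sqrt n * Metric.diam (Spoly v) ≤ Real.sqrt n * (2 * |v none|) := by gcongr
          have h4 : ε ≤ Real.sqrt n * Metric.diam (Spoly v) := hv
          linarith
      _ = e := by simp
  · intro x r hx ε hε
    rw [Metric.mem_ball] at hx
    set q' : EuclideanSpace ℝ (Fin 4) := (WithLp.equiv 2 (Fin 4 → ℝ)).symm q with hq'
    set ρ := r - dist q' x with hρ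
    have hρ0 : 0 < ρ := by linarith
    set δ := ρ / 8 with hδ
    have hδ0 : 0 < δ := by positivity
    have hb := bad_tendsto hδ0 (ε := ENNReal.ofReal (ε / 2)) (by simpa using hε)
    have hT : Tendsto (fun n : ℕ => ENNReal.ofReal (4 / (δ ^ 2 * n))) atTop (𝓝 0) := by
      rw [← ENNReal.ofReal_zero]
      refine ENNReal.tendsto_ofReal (Tendsto.const_div_atTop ?_ _)
      exact tendsto_natCast_atTop_atTop.const_mul_atTop (by positivity)
    refine tendsto_of_tendsto_of_tendsto_of_le_of_le' tendsto_const_nhds hT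
      (Eventually.of_forall fun _ => zero_le) ?_
    filter_upwards [hb, eventually_gt_atTop 0] with n hbn hn
    have hn' : (1 : ℝ) ≤ n := by exact_mod_cast hn
    have key : multinomial (Fin 4) n q
        {c | ε ≤ |1 - ((dirichlet (shapeOf4 c)) {v | Spoly v ⊆ Metric.ball x r}).toReal|}
        ≤ multinomial (Fin 4) n q (⋃ i, {c | δ ≤ |(c i : ℝ) / n - q i|}) := by
      refine measure_mono_ae ?_
      filter_upwards [multinomial_sum q n] with c hc
      intro hcε
      by_contra hcon
      have hcon' : ∀ i, |(c i : ℝ) / n - q i| < δ := by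
        intro i
        by_contra h
        exact hcon (Set.mem_iUnion.mpr ⟨i, not_lt.mp h⟩)
      have hD := dir_prob c
      have hsub : Good n c δ ⊆ {v | Spoly v ⊆ Metric.ball x r} := by
        intro v hv y hy
        have h0 : |v none| ≤ δ := by
          have : 1 * |v none| ≤ Real.sqrt n * |v none| := by
            gcongr; exact Real.one_le_sqrt.mpr hn'
          linarith [hv.2.1]
        have hd : dist y q' ≤ 2 * (3 * δ) := by
          refine dist_le_of (by positivity) fun i => ?_
          show |y i - q i| ≤ 3 * δ
          have h1 := spoly_coord hv.1 hy i
          have h2 := abs_le.mp (hv.2.2 i)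
          have h3 := abs_lt.mp (hcon' i)
          have h4 := abs_le.mp h0
          rw [abs_le]; constructor <;> linarith
        rw [Metric.mem_ball]
        have := dist_triangle y q' x
        linarith
      have hG : dirichlet (shapeOf4 c) {v | Spoly v ⊆ Metric.ball x r}ᶜ
          ≤ ENNReal.ofReal (ε / 2) :=
        (measure_mono (Set.compl_subset_compl.mpr hsub)).trans (hbn c hc)
      have h1 : 1 ≤ dirichlet (shapeOf4 c) {v | Spoly v ⊆ Metric.ball x r}
          + ENNReal.ofReal (ε / 2) := by
        calc (1 : ℝ≥0∞) = dirichlet (shapeOf4 c) Set.univ := measure_univ.symm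
          _ ≤ _ := by
            rw [← Set.union_compl_self {v | Spoly v ⊆ Metric.ball x r}]
            exact (measure_union_le _ _).trans (by gcongr)
      have hfin : dirichlet (shapeOf4 c) {v | Spoly v ⊆ Metric.ball x r} ≠ ∞ := measure_ne_top _ _
      have h2 : 1 ≤ (dirichlet (shapeOf4 c) {v | Spoly v ⊆ Metric.ball x r}).toReal + ε / 2 := by
        have := ENNReal.toReal_mono (by simp [hfin]) h1
        rwa [ENNReal.toReal_add hfin (by simp), ENNReal.toReal_ofReal (by positivity),
          ENNReal.toReal_one] at this
      have h3 : (dirichlet (shapeOf4 c) {v | Spoly v ⊆ Metric.ball x r}).toReal ≤ 1 := by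
        have := ENNReal.toReal_mono (by simp)
          (prob_le_one (μ := dirichlet (shapeOf4 c)) (s := {v | Spoly v ⊆ Metric.ball x r}))
        simpa using this
      have h4 : ε ≤ |1 - (dirichlet (shapeOf4 c) {v | Spoly v ⊆ Metric.ball x r}).toReal| := hcε
      rw [abs_of_nonneg (by linarith)] at h4
      linarith
    refine key.trans ((measure_iUnion_fintype_le _ _).trans
      ((Finset.sum_le_sum fun i _ => multinomial_cheb hq n hn i hδ0).trans ?_))
    rw [← ENNReal.ofReal_sum_of_nonneg (fun _ _ => by positivity)]
    refine ENNReal.ofReal_le_ofReal (le_of_eq ?_)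
    simp; ring
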